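/- arXiv:2307.11392 — 2 statements merged into one kernel-verified Lean document; each statement's English description precedes it below -/
import Mathlib

section
/- Let X(ℝⁿ) be a ball quasi-Banach function space having an absolutely continuous quasi-norm, and Ω ⊂ ℝⁿ an open set. Then C_c^∞(Ω), the smooth compactly supported functions on Ω, is dense in the restrictive space X(Ω). -/
open MeasureTheory Filter Topology ENNReal Metric Set
open scoped RealInnerProductSpace

noncomputable section

/-- A ball quasi-Banach function space on `ℝⁿ`. -/
structure BQBF (n : ℕ) where
  N : (EuclideanSpace ℝ (Fin n) → ℝ) → ℝ≥0∞
  quasi : ∃ C : ℝ≥0∞, 1 ≤ C ∧ C < ∞ ∧ ∀ f g, N (f + g) ≤ C * (N f + N g)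
  smul : ∀ (c : ℝ) (f), N (fun x => c * f x) = ENNReal.ofReal |c| * N f
  eq_zero : ∀ f, N f = 0 → ∀ᵐ x : EuclideanSpace ℝ (Fin n), f x = 0
  mono : ∀ f g : EuclideanSpace ℝ (Fin n) → ℝ,
    (∀ᵐ x : EuclideanSpace ℝ (Fin n), |g x| ≤ |f x|) → N g ≤ N f
  fatou : ∀ (f : ℕ → EuclideanSpace ℝ (Fin n) → ℝ) (F : EuclideanSpace ℝ (Fin n) → ℝ),
    (∀ᵐ x : EuclideanSpace ℝ (Fin n), Monotone fun m => f m x) →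
    (∀ᵐ x : EuclideanSpace ℝ (Fin n), ∀ m, 0 ≤ f m x) →
    (∀ᵐ x : EuclideanSpace ℝ (Fin n), Tendsto (fun m => f m x) atTop (nhds (F x))) →
    Tendsto (fun m => N (f m)) atTop (nhds (N F))
  ball_fin : ∀ (x : EuclideanSpace ℝ (Fin n)) (r : ℝ), 0 < r →
    N (Set.indicator (Metric.ball x r) fun _ => (1 : ℝ)) < ∞

/-- A ball Banach function space on `ℝⁿ`. -/
structure BBF (n : ℕ) extends BQBF n where
  triangle : ∀ f g, N (f + g) ≤ N f + N g
  locL1 : ∀ (x : EuclideanSpace ℝ (Fin n)) (r : ℝ), 0 < r → ∃ C : ℝ≥0∞, C < ∞ ∧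
    ∀ f, (∫⁻ y in Metric.ball x r, (‖f y‖₊ : ℝ≥0∞)) ≤ C * N f

/-- The associate (Köthe dual) norm of a ball Banach function space. -/
def BBF.assocN {n : ℕ} (X : BBF n) (g : EuclideanSpace ℝ (Fin n) → ℝ) : ℝ≥0∞ :=
  ⨆ (f : EuclideanSpace ℝ (Fin n) → ℝ) (_ : X.N f = 1), ∫⁻ x, (‖f x * g x‖₊ : ℝ≥0∞)

/-- Absolute continuity of a (quasi-)norm functional. -/
def ACNorm {n : ℕ} (Nn : (EuclideanSpace ℝ (Fin n) → ℝ) → ℝ≥0∞) : Prop :=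
  ∀ f : EuclideanSpace ℝ (Fin n) → ℝ, Nn f < ∞ →
    ∀ Es : ℕ → Set (EuclideanSpace ℝ (Fin n)), (∀ j, MeasurableSet (Es j)) →
    (∀ᵐ x : EuclideanSpace ℝ (Fin n),
      Tendsto (fun j => (Es j).indicator (fun _ => (1 : ℝ)) x) atTop (nhds 0)) →
    Tendsto (fun j => Nn ((Es j).indicator f)) atTop (nhds 0)

/-- A `ν₀`-radial decreasing approximation of the identity on `ℝⁿ`. -/
structure IsRDATI (n : ℕ) (ν₀ : ℝ) (ρ : ℝ → ℝ → ℝ) : Prop where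
  pos : 0 < ν₀
  nonneg : ∀ ν ∈ Set.Ioo (0:ℝ) ν₀, ∀ r : ℝ, 0 < r → 0 ≤ ρ ν r
  anti : ∀ ν ∈ Set.Ioo (0:ℝ) ν₀, AntitoneOn (ρ ν) (Set.Ioi 0)
  locint : ∀ ν ∈ Set.Ioo (0:ℝ) ν₀, LocallyIntegrableOn (ρ ν) (Set.Ioi 0)
  norm_one : ∀ ν ∈ Set.Ioo (0:ℝ) ν₀, ∫ r in Set.Ioi (0:ℝ), ρ ν r * r ^ ((n:ℝ) - 1) = 1
  tail : ∀ δ : ℝ, 0 < δ →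
    Tendsto (fun ν => ∫ r in Set.Ioi δ, ρ ν r * r ^ ((n:ℝ) - 1))
      (nhdsWithin 0 (Set.Ioo 0 ν₀)) (nhds 0)

/-- An `(ε,∞)`-domain (Jones uniform domain). -/
def IsUniformDomain {n : ℕ} (ε : ℝ) (Ω : Set (EuclideanSpace ℝ (Fin n))) : Prop :=
  IsOpen Ω ∧ ∀ x ∈ Ω, ∀ y ∈ Ω, x ≠ y → ∃ γ : ℝ → EuclideanSpace ℝ (Fin n),
    ContinuousOn γ (Set.Icc 0 1) ∧ γ 0 = x ∧ γ 1 = y ∧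
    (∀ t ∈ Set.Icc (0:ℝ) 1, γ t ∈ Ω) ∧
    eVariationOn γ (Set.Icc 0 1) ≤ ENNReal.ofReal (ε⁻¹ * dist x y) ∧
    ∀ t ∈ Set.Icc (0:ℝ) 1,
      ε * dist x (γ t) * dist y (γ t) / dist x y ≤ Metric.infDist (γ t) (frontier Ω)

/-- `g` is a weak gradient of `f` on the open set `Ω`. -/
def HasWeakGradient {n : ℕ} (Ω : Set (EuclideanSpace ℝ (Fin n)))
    (f : EuclideanSpace ℝ (Fin n) → ℝ)
    (g : EuclideanSpace ℝ (Fin n) → EuclideanSpace ℝ (Fin n)) : Prop :=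
  ∀ j : Fin n, ∀ φ : EuclideanSpace ℝ (Fin n) → ℝ,
    ContDiff ℝ (⊤ : ℕ∞) φ → HasCompactSupport φ → tsupport φ ⊆ Ω →
    ∫ x in Ω, f x * fderiv ℝ φ x (EuclideanSpace.single j 1)
      = - ∫ x in Ω, ⟪g x, EuclideanSpace.single j 1⟫ * φ x

/-- The constant `κ(p,n)`. -/
def kappa (p : ℝ) (n : ℕ) : ℝ :=
  2 * Real.pi ^ (((n:ℝ) - 1) / 2) * Real.Gamma ((p + 1) / 2) / Real.Gamma ((p + (n:ℝ)) / 2)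

/-- Hardy–Littlewood maximal function (uncentered, over balls), `ℝ≥0∞`-valued. -/
def HLM {n : ℕ} (f : EuclideanSpace ℝ (Fin n) → ℝ) (x : EuclideanSpace ℝ (Fin n)) : ℝ≥0∞ :=
  ⨆ (c : EuclideanSpace ℝ (Fin n)) (r : ℝ) (_ : 0 < r) (_ : x ∈ Metric.ball c r),
    (volume (Metric.ball c r))⁻¹ * ∫⁻ y in Metric.ball c r, (‖f y‖₊ : ℝ≥0∞)

/-- An axis-parallel open cube with center `x` and half side-length `r`. -/
def cube {n : ℕ} (x : EuclideanSpace ℝ (Fin n)) (r : ℝ) : Set (EuclideanSpace ℝ (Fin n)) :=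
  {y | ∀ i : Fin n, |⟪y - x, EuclideanSpace.single i 1⟫| < r}

/-- The Muckenhoupt `A₁` characteristic. -/
def A1const {n : ℕ} (ω : EuclideanSpace ℝ (Fin n) → ℝ) : ℝ≥0∞ :=
  ⨆ (x : EuclideanSpace ℝ (Fin n)) (r : ℝ) (_ : 0 < r),
    essSup (fun y => ENNReal.ofReal (ω y)⁻¹) (volume.restrict (cube x r)) *
      ((volume (cube x r))⁻¹ * ∫⁻ y in cube x r, ENNReal.ofReal (ω y))

/-- The Muckenhoupt `A_q` characteristic, `q ∈ [1,∞)`. -/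
def ApConst {n : ℕ} (q : ℝ) (ω : EuclideanSpace ℝ (Fin n) → ℝ) : ℝ≥0∞ :=
  if q = 1 then A1const ω else
  ⨆ (x : EuclideanSpace ℝ (Fin n)) (r : ℝ) (_ : 0 < r),
    ((volume (cube x r))⁻¹ * ∫⁻ y in cube x r, ENNReal.ofReal (ω y)) *
      ((volume (cube x r))⁻¹ * ∫⁻ y in cube x r, ENNReal.ofReal (ω y ^ (-(q-1)⁻¹))) ^ (q - 1)

namespace BQBF

variable {n : ℕ} (X : BQBF n)

theorem N_mono {f g : EuclideanSpace ℝ (Fin n) → ℝ} (h : ∀ x, |g x| ≤ |f x|) : X.N g ≤ X.N f :=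
  X.mono f g (Eventually.of_forall h)

theorem N_indicator_one_lt_top {K : Set (EuclideanSpace ℝ (Fin n))} (hK : Bornology.IsBounded K) :
    X.N (K.indicator fun _ => (1 : ℝ)) < ∞ := by
  obtain ⟨r, hr, hKr⟩ := hK.subset_ball_lt 0 0
  refine (X.N_mono fun x => ?_).trans_lt (X.ball_fin 0 r hr)
  by_cases hx : x ∈ K
  · simp [hx, hKr hx]
  · simp [hx]

/-- Sums of two small functions are small, despite the quasi-triangle constant. -/
theorem exists_N_add_lt {ε : ℝ≥0∞} (hε : 0 < ε) :
    ∃ η : ℝ≥0∞, 0 < η ∧ ∀ f g, X.N f < η → X.N g < η → X.N (f + g) < ε := by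
  obtain ⟨C, -, hC, hquasi⟩ := X.quasi
  have hlim : Tendsto (fun η : ℝ≥0∞ => C * (η + η)) (𝓝[>] 0) (𝓝 0) := by
    have h0 : Tendsto (fun η : ℝ≥0∞ => η) (𝓝[>] 0) (𝓝 0) := nhdsWithin_le_nhds
    simpa using ENNReal.Tendsto.const_mul (h0.add h0) (Or.inr hC.ne)
  obtain ⟨η, hηε, hη⟩ := ((hlim.eventually (gt_mem_nhds hε)).and self_mem_nhdsWithin).exists
  refine ⟨η, hη, fun f g hf hg => (hquasi f g).trans_lt (lt_of_le_of_lt ?_ hηε)⟩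
  gcongr

/-- Bounded convergence: a uniformly bounded sequence supported in a fixed bounded set and tending
to zero almost everywhere tends to zero in an absolutely continuous quasi-norm. -/
theorem tendsto_N_zero_of_bounded (hX : ACNorm X.N) {K : Set (EuclideanSpace ℝ (Fin n))}
    (hK : Bornology.IsBounded K) {M : ℝ} {u : ℕ → EuclideanSpace ℝ (Fin n) → ℝ}
    (hum : ∀ k, Measurable (u k)) (huM : ∀ k x, |u k x| ≤ M)
    (huK : ∀ k x, x ∉ K → u k x = 0)
    (hu : ∀ᵐ x : EuclideanSpace ℝ (Fin n), Tendsto (fun k => u k x) atTop (𝓝 0)) :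
    Tendsto (fun k => X.N (u k)) atTop (𝓝 0) := by
  have hM : 0 ≤ M := (abs_nonneg _).trans (huM 0 0)
  have hKfin := X.N_indicator_one_lt_top hK
  refine ENNReal.tendsto_nhds_zero.2 fun ε hε => ?_
  obtain ⟨η, hη, hadd⟩ := X.exists_N_add_lt hε
  obtain ⟨δ, hδη, hδ⟩ : ∃ δ : ℝ, X.N (fun x => δ * K.indicator (fun _ => (1 : ℝ)) x) < η ∧
      0 < δ := by
    have h0 : Tendsto (fun δ : ℝ => ENNReal.ofReal |δ|) (𝓝[>] 0) (𝓝 0) := by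
      have : Tendsto (fun δ : ℝ => ENNReal.ofReal |δ|) (𝓝 0) (𝓝 (ENNReal.ofReal |0|)) :=
        (ENNReal.continuous_ofReal.comp continuous_abs).tendsto 0
      simpa using this.mono_left nhdsWithin_le_nhds
    have hlim : Tendsto (fun δ : ℝ => X.N (fun x => δ * K.indicator (fun _ => (1 : ℝ)) x))
        (𝓝[>] 0) (𝓝 0) := by
      simp only [X.smul]
      simpa using ENNReal.Tendsto.mul_const h0 (Or.inr hKfin.ne)
    exact ((hlim.eventually (gt_mem_nhds hη)).and self_mem_nhdsWithin).exists
  have hMfin : X.N (fun x => M * K.indicator (fun _ => (1 : ℝ)) x) < ∞ := by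
    rw [X.smul]
    exact ENNReal.mul_lt_top ENNReal.ofReal_lt_top hKfin
  have hE := hX _ hMfin (fun k => {x | δ < |u k x|})
    (fun k => measurableSet_lt measurable_const (hum k).abs) (by
      filter_upwards [hu] with x hx
      refine tendsto_const_nhds.congr' ?_
      have := hx.abs
      rw [abs_zero] at this
      filter_upwards [this.eventually (gt_mem_nhds hδ)] with k hk
      simp [hk.le])
  filter_upwards [hE.eventually (gt_mem_nhds hη)] with k hk
  refine (X.N_mono fun x => ?_).trans (hadd _ _ hδη hk).le
  by_cases hxK : x ∈ K
  · by_cases hx : δ < |u k x|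
    · simp only [Pi.add_apply, indicator_of_mem hxK, mul_one,
        indicator_of_mem (show x ∈ {x | δ < |u k x|} from hx)]
      rw [abs_of_nonneg (add_nonneg hδ.le hM)]
      linarith [huM k x]
    · simp only [Pi.add_apply, indicator_of_mem hxK, mul_one,
        indicator_of_notMem (show x ∉ {x | δ < |u k x|} from hx), add_zero]
      rw [abs_of_pos hδ]
      exact not_lt.1 hx
  · simp [huK k x hxK]

/-- Truncation: every element of the restrictive space on an open set is approximated by bounded
functions supported in a compact subset. -/
theorem exists_truncation_N_sub_lt (hX : ACNorm X.N) {Ω : Set (EuclideanSpace ℝ (Fin n))}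
    (hΩ : IsOpen Ω) {f : EuclideanSpace ℝ (Fin n) → ℝ} (hfm : Measurable f)
    (hf : X.N (Ω.indicator f) < ∞) {ε : ℝ≥0∞} (hε : 0 < ε) :
    ∃ (h : EuclideanSpace ℝ (Fin n) → ℝ) (M : ℝ) (K : Set (EuclideanSpace ℝ (Fin n))),
      Measurable h ∧ (∀ x, |h x| ≤ M) ∧ IsCompact K ∧ K ⊆ Ω ∧ Function.support h ⊆ K ∧
        X.N (Ω.indicator (f - h)) < ε := by
  obtain ⟨F, hFc, hFΩ, hFU, hFmono⟩ := hΩ.exists_iUnion_isClosed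
  let A : ℕ → Set (EuclideanSpace ℝ (Fin n)) :=
    fun j => (F j ∩ closedBall 0 j) ∩ {x | |f x| ≤ j}
  have hA : ∀ j, MeasurableSet (A j) := fun j =>
    ((hFc j).measurableSet.inter isClosed_closedBall.measurableSet).inter
      (measurableSet_le hfm.abs measurable_const)
  have hE := hX _ hf (fun j => Ω \ A j) (fun j => hΩ.measurableSet.diff (hA j))
    (Eventually.of_forall fun x => by
      refine tendsto_const_nhds.congr' ?_
      by_cases hx : x ∈ Ω
      · obtain ⟨i, hi⟩ := mem_iUnion.1 (hFU ▸ hx)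
        filter_upwards [eventually_ge_atTop i,
          tendsto_natCast_atTop_atTop.eventually_ge_atTop ‖x‖,
          tendsto_natCast_atTop_atTop.eventually_ge_atTop |f x|] with j h1 h2 h3
        have : x ∈ A j := ⟨⟨hFmono h1 hi, by simpa using h2⟩, h3⟩
        simp [this]
      · simp [hx])
  obtain ⟨j, hj⟩ := (hE.eventually (gt_mem_nhds hε)).exists
  refine ⟨(A j).indicator f, j, F j ∩ closedBall 0 j, hfm.indicator (hA j), fun x => ?_,
    (isCompact_closedBall _ _).inter_left (hFc j), inter_subset_left.trans (hFΩ j),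
    support_indicator_subset.trans inter_subset_left, ?_⟩
  · by_cases hx : x ∈ A j
    · simpa [hx] using hx.2
    · simp [hx]
  · convert hj using 2
    ext x
    by_cases hx : x ∈ Ω <;> by_cases hxA : x ∈ A j <;> simp [hx, hxA]

/-- Mollification: a bounded measurable function supported in a compact subset of an open set is
approximated by smooth functions compactly supported in that open set. -/
theorem exists_contDiff_N_sub_lt (hX : ACNorm X.N) {Ω K : Set (EuclideanSpace ℝ (Fin n))}
    (hΩ : IsOpen Ω) (hK : IsCompact K) (hKΩ : K ⊆ Ω) {h : EuclideanSpace ℝ (Fin n) → ℝ}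
    (hm : Measurable h) {M : ℝ} (hM : ∀ x, |h x| ≤ M) (hsupp : Function.support h ⊆ K)
    {ε : ℝ≥0∞} (hε : 0 < ε) :
    ∃ φ : EuclideanSpace ℝ (Fin n) → ℝ, ContDiff ℝ (⊤ : ℕ∞) φ ∧ HasCompactSupport φ ∧
      tsupport φ ⊆ Ω ∧ X.N (h - φ) < ε := by
  obtain ⟨δ, hδ, hδΩ⟩ := hK.exists_cthickening_subset_open hΩ hKΩ
  have hK' : IsCompact (cthickening δ K) := hK.cthickening
  let ψ : ℕ → ContDiffBump (0 : EuclideanSpace ℝ (Fin n)) := fun k =>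
    { rIn := δ / (k + 1) / 2
      rOut := δ / (k + 1)
      rIn_pos := by positivity
      rIn_lt_rOut := half_lt_self (by positivity) }
  let u : ℕ → EuclideanSpace ℝ (Fin n) → ℝ := fun k =>
    convolution ((ψ k).normed volume) h (ContinuousLinearMap.lsmul ℝ ℝ) volume
  have hint : Integrable h := by
    refine (integrableOn_iff_integrable_of_support_subset hsupp).1 ?_
    exact Measure.integrableOn_of_bounded hK.measure_lt_top.ne hm.aestronglyMeasurable
      (Eventually.of_forall hM)
  have hsmooth : ∀ k, ContDiff ℝ (⊤ : ℕ∞) (u k) := fun k =>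
    (ψ k).hasCompactSupport_normed.contDiff_convolution_left _ (ψ k).contDiff_normed
      hint.locallyIntegrable
  have husupp : ∀ k, Function.support (u k) ⊆ cthickening δ K := fun k => by
    refine (support_convolution_subset _).trans ?_
    rw [(ψ k).support_normed_eq]
    rintro _ ⟨x, hx, y, hy, rfl⟩
    refine thickening_subset_cthickening _ _ (mem_thickening_iff.2 ⟨y, hsupp hy, ?_⟩)
    have hx' : ‖x‖ < δ / (k + 1) := by simpa using hx
    have : δ / (k + 1 : ℝ) ≤ δ := div_le_self hδ.le (by linarith [k.cast_nonneg (α := ℝ)])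
    simpa [dist_eq_norm] using hx'.trans_le this
  have hbound : ∀ k x, |h x - u k x| ≤ 2 * M := fun k x => by
    rw [abs_sub_comm, ← Real.dist_eq]
    refine (ψ k).dist_normed_convolution_le hm.aestronglyMeasurable fun y _ => ?_
    rw [Real.dist_eq]
    linarith [abs_sub (h y) (h x), hM x, hM y]
  have hrOut : Tendsto (fun k => (ψ k).rOut) atTop (𝓝 0) :=
    tendsto_const_nhds.div_atTop (tendsto_natCast_atTop_atTop.atTop_add tendsto_const_nhds)
  have hconv : ∀ᵐ x : EuclideanSpace ℝ (Fin n), Tendsto (fun k => u k x) atTop (𝓝 (h x)) :=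
    ContDiffBump.ae_convolution_tendsto_right_of_locallyIntegrable (K := 2) hrOut
      (Eventually.of_forall fun k => (mul_div_cancel₀ (δ / ((k : ℝ) + 1)) two_ne_zero).ge)
      hint.locallyIntegrable
  have hlim := X.tendsto_N_zero_of_bounded hX hK'.isBounded (u := fun k => h - u k)
    (fun k => hm.sub (hsmooth k).continuous.measurable) hbound
    (fun k x hx => by
      have h1 : h x = 0 := Function.notMem_support.1 fun hx' =>
        hx (self_subset_cthickening _ (hsupp hx'))
      have h2 : u k x = 0 := Function.notMem_support.1 fun hx' => hx (husupp k hx')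
      simp [h1, h2])
    (by
      filter_upwards [hconv] with x hx
      simpa using hx.const_sub (h x))
  obtain ⟨k, hk⟩ := (hlim.eventually (gt_mem_nhds hε)).exists
  exact ⟨u k, hsmooth k, HasCompactSupport.of_support_subset_isCompact hK' (husupp k),
    (closure_minimal (husupp k) isClosed_cthickening).trans hδΩ, hk⟩

end BQBF

theorem smooth_compactly_supported_dense_in_restrictive_space (n : ℕ) (X : BQBF n)
    (hX : ACNorm X.N) (Ω : Set (EuclideanSpace ℝ (Fin n))) (hΩ : IsOpen Ω)
    (f : EuclideanSpace ℝ (Fin n) → ℝ) (hfm : Measurable f)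
    (hf : X.N (Ω.indicator f) < ∞) (ε : ℝ≥0∞) (hε : 0 < ε) :
    ∃ φ : EuclideanSpace ℝ (Fin n) → ℝ, ContDiff ℝ (⊤ : ℕ∞) φ ∧ HasCompactSupport φ ∧
      tsupport φ ⊆ Ω ∧ X.N (Ω.indicator (f - φ)) < ε := by
  obtain ⟨η, hη, hadd⟩ := X.exists_N_add_lt hε
  obtain ⟨h, M, K, hm, hM, hK, hKΩ, hsupp, hfh⟩ := X.exists_truncation_N_sub_lt hX hΩ hfm hf hη
  obtain ⟨φ, hφ, hφc, hφΩ, hhφ⟩ := X.exists_contDiff_N_sub_lt hX hΩ hK hKΩ hm hM hsupp hη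
  refine ⟨φ, hφ, hφc, hφΩ, (X.N_mono fun x => ?_).trans_lt (hadd _ _ hfh hhφ)⟩
  by_cases hx : x ∈ Ω <;> simp [hx]

end
end

section
/- Let Ω ⊂ ℝⁿ be a bounded (ε,∞)-domain with ε ∈ (0,1], p ∈ (0,∞), {ρ_ν}_{ν∈(0,ν₀)} a ν₀-RDATI on ℝⁿ, and f ∈ C^∞(Ω̄). Then for every x ∈ Ω, lim_{ν→0⁺} ∫_Ω (|f(x)−f(y)|^p / |x−y|^p) ρ_ν(|x−y|) dy = κ(p,n)·|∇f(x)|^p, where κ(p,n) = ∫_{𝕊^{n-1}} |e·ω|^p dσ(ω) for any unit vector e. -/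
open MeasureTheory Filter Topology ENNReal Metric Set
open scoped RealInnerProductSpace

noncomputable section

section PolarCoordinates

variable {E : Type*} [NormedAddCommGroup E]

/-- Integration in polar coordinates of the product of a function that is positively homogeneous
of degree zero and a radial function. -/
lemma integral_homogeneous_mul_radial [NormedSpace ℝ E] [MeasurableSpace E] [BorelSpace E]
    [FiniteDimensional ℝ E] [Nontrivial E] (μ : Measure E) [μ.IsAddHaarMeasure]
    {h : E → ℝ} (hh : ∀ r : ℝ, 0 < r → ∀ z, h (r • z) = h z) (φ : ℝ → ℝ) :
    ∫ z, h z * φ ‖z‖ ∂μ =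
      (∫ ω : sphere (0 : E) 1, h ω ∂μ.toSphere) *
        ∫ r in Ioi (0 : ℝ), r ^ (Module.finrank ℝ E - 1) * φ r :=
  calc
    ∫ z, h z * φ ‖z‖ ∂μ = ∫ z : ({(0)}ᶜ : Set E), h z.1 * φ ‖z.1‖ ∂(μ.comap (↑)) := by
      rw [integral_subtype_comap (measurableSet_singleton _).compl fun z ↦ h z * φ ‖z‖,
        restrict_compl_singleton]
    _ = ∫ q, h q.1 * φ q.2 ∂μ.toSphere.prod (.volumeIoiPow (Module.finrank ℝ E - 1)) := by
      rw [← μ.measurePreserving_homeomorphUnitSphereProd.integral_comp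
        (Homeomorph.measurableEmbedding _)
        (fun q : sphere (0 : E) 1 × Ioi (0 : ℝ) ↦ h q.1 * φ q.2)]
      refine integral_congr_ae (.of_forall fun z ↦ ?_)
      have hz : 0 < ‖z.1‖⁻¹ := inv_pos.2 (norm_pos_iff.2 z.2)
      simp [hh _ hz]
    _ = (∫ ω : sphere (0 : E) 1, h ω ∂μ.toSphere) *
        ∫ r : Ioi (0 : ℝ), φ r ∂.volumeIoiPow (Module.finrank ℝ E - 1) :=
      integral_prod_mul (fun ω : sphere (0 : E) 1 ↦ h ω) (fun r : Ioi (0 : ℝ) ↦ φ r)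
    _ = _ := by
      congr 1
      simp only [Measure.volumeIoiPow, ENNReal.ofReal]
      rw [integral_withDensity_eq_integral_smul,
        integral_subtype_comap measurableSet_Ioi
          fun a ↦ Real.toNNReal (a ^ (Module.finrank ℝ E - 1)) • φ a,
        setIntegral_congr_fun measurableSet_Ioi fun x hx ↦ ?_]
      · rw [NNReal.smul_def, Real.coe_toNNReal _ (pow_nonneg hx.out.le _), smul_eq_mul]
      · exact (measurable_subtype_coe.pow_const _).real_toNNReal

variable [InnerProductSpace ℝ E]

/-- The directional factor `|⟪v, z / ‖z‖⟫| ^ p`. -/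
def directional (p : ℝ) (v z : E) : ℝ := (|⟪v, z⟫| / ‖z‖) ^ p

lemma directional_smul_right (p : ℝ) (v : E) {r : ℝ} (hr : 0 < r) (z : E) :
    directional p v (r • z) = directional p v z := by
  unfold directional
  rw [inner_smul_right, norm_smul, abs_mul, Real.norm_eq_abs, mul_div_mul_left _ _ (by positivity)]

lemma directional_smul_left (p : ℝ) (v : E) {c : ℝ} (hc : 0 ≤ c) (z : E) :
    directional p (c • v) z = c ^ p * directional p v z := by
  unfold directional
  rw [real_inner_smul_left, abs_mul, abs_of_nonneg hc, mul_div_assoc,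
    Real.mul_rpow hc (by positivity)]

lemma directional_map (p : ℝ) (R : E ≃ₗᵢ[ℝ] E) (v z : E) :
    directional p (R v) (R z) = directional p v z := by
  simp [directional]

lemma directional_nonneg (p : ℝ) (v z : E) : 0 ≤ directional p v z := by
  unfold directional; positivity

lemma abs_inner_div_norm_le (v z : E) : |⟪v, z⟫| / ‖z‖ ≤ ‖v‖ :=
  div_le_of_le_mul₀ (norm_nonneg _) (norm_nonneg _) (abs_real_inner_le_norm v z)

lemma directional_le {p : ℝ} (hp : 0 ≤ p) (v z : E) : directional p v z ≤ ‖v‖ ^ p :=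
  Real.rpow_le_rpow (by positivity) (abs_inner_div_norm_le v z) hp

lemma measurable_directional [MeasurableSpace E] [BorelSpace E] (p : ℝ) (v : E) :
    Measurable (directional p v) := by
  unfold directional
  have h1 : Measurable fun z : E ↦ |⟪v, z⟫| :=
    (continuous_const.inner continuous_id).abs.measurable
  exact (h1.div continuous_norm.measurable).pow_const p

/-- Rotation invariance: against a radial weight, `directional p v` integrates to `‖v‖ ^ p` times
the integral for a unit vector. -/
lemma integral_directional_mul_radial [MeasurableSpace E] [BorelSpace E] [FiniteDimensional ℝ E]
    {p : ℝ} (hp : 0 < p) {e : E} (he : ‖e‖ = 1) (v : E) (φ : ℝ → ℝ) :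
    ∫ z, directional p v z * φ ‖z‖ = ‖v‖ ^ p * ∫ z, directional p e z * φ ‖z‖ := by
  rcases eq_or_ne v 0 with rfl | hv
  · simp [directional, Real.zero_rpow hp.ne']
  set u : E := ‖v‖⁻¹ • v
  have hu : ‖u‖ = 1 := norm_smul_inv_norm hv
  set R : E ≃ₗᵢ[ℝ] E := (ℝ ∙ (e - u))ᗮ.reflection
  have hR : R e = u := Submodule.reflection_sub (he.trans hu.symm)
  have hvu : v = ‖v‖ • R e := by rw [hR, smul_inv_smul₀ (norm_ne_zero_iff.2 hv)]
  rw [← R.measurePreserving.integral_comp R.toHomeomorph.measurableEmbedding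
      (fun z ↦ directional p v z * φ ‖z‖), ← integral_const_mul]
  congr 1 with z
  conv_lhs => rw [hvu]
  rw [directional_smul_left _ _ (norm_nonneg v), directional_map, R.norm_map, mul_assoc]

end PolarCoordinates

/-- If `F` is differentiable at `x`, then the `p`-th power of its difference quotient is
asymptotic to the directional factor of its gradient. -/
lemma DifferentiableAt.tendsto_slope_rpow_sub_directional {E : Type*} [NormedAddCommGroup E]
    [InnerProductSpace ℝ E] [CompleteSpace E] {F : E → ℝ} {x : E} (hF : DifferentiableAt ℝ F x)
    {p : ℝ} (hp : 0 < p) :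
    Tendsto (fun y ↦ (|F x - F y| / ‖y - x‖) ^ p - directional p (gradient F x) (y - x))
      (𝓝 x) (𝓝 0) := by
  set v := gradient F x
  have ho := hasGradientAt_iff_isLittleO.1 hF.hasGradientAt
  have huc : UniformContinuousOn (fun t : ℝ ↦ t ^ p) (Icc 0 (‖v‖ + 1)) :=
    isCompact_Icc.uniformContinuousOn_of_continuous
      (Real.continuous_rpow_const hp.le).continuousOn
  rw [Metric.uniformContinuousOn_iff] at huc
  refine Metric.tendsto_nhds.2 fun η hη ↦ ?_
  obtain ⟨δ, hδ, hδ'⟩ := huc η hη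
  have hc : 0 < min (δ / 2) 1 := by positivity
  filter_upwards [ho.bound hc] with y hy
  have key : |(|F x - F y| / ‖y - x‖) - |⟪v, y - x⟫| / ‖y - x‖| ≤ min (δ / 2) 1 := by
    rw [← sub_div, abs_div, abs_norm]
    refine div_le_of_le_mul₀ (norm_nonneg _) hc.le (le_trans ?_ hy)
    rw [abs_sub_comm (F x)]
    exact abs_abs_sub_abs_le_abs_sub _ _
  have hb := abs_inner_div_norm_le v (y - x)
  have h1 := (abs_le.1 (key.trans (min_le_right _ _))).2
  have := hδ' (|F x - F y| / ‖y - x‖) ⟨by positivity, by linarith⟩ (|⟪v, y - x⟫| / ‖y - x‖)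
    ⟨by positivity, by linarith⟩
    (by rw [Real.dist_eq]; linarith [key.trans (min_le_left _ _)])
  rw [Real.dist_eq] at this ⊢
  rw [sub_zero]
  exact this

namespace IsRDATI

variable {n : ℕ} {ν₀ : ℝ} {ρ : ℝ → ℝ → ℝ}

lemma rpow_eq_pow (hn : 1 ≤ n) (r : ℝ) : r ^ ((n : ℝ) - 1) = r ^ (n - 1) := by
  rw [← Nat.cast_pred hn, Real.rpow_natCast]

lemma integral_pow (hρ : IsRDATI n ν₀ ρ) (hn : 1 ≤ n) {ν : ℝ} (hν : ν ∈ Ioo 0 ν₀) :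
    ∫ r in Ioi (0 : ℝ), r ^ (n - 1) * ρ ν r = 1 := by
  simpa only [rpow_eq_pow hn, mul_comm] using hρ.norm_one ν hν

lemma integrableOn_pow (hρ : IsRDATI n ν₀ ρ) (hn : 1 ≤ n) {ν : ℝ} (hν : ν ∈ Ioo 0 ν₀) :
    IntegrableOn (fun r ↦ r ^ (n - 1) * ρ ν r) (Ioi 0) :=
  not_imp_comm.1 integral_undef (by rw [hρ.integral_pow hn hν]; exact one_ne_zero)

variable [Nontrivial (EuclideanSpace ℝ (Fin n))]

lemma integrable_norm (hρ : IsRDATI n ν₀ ρ) (hn : 1 ≤ n) {ν : ℝ} (hν : ν ∈ Ioo 0 ν₀) :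
    Integrable fun z : EuclideanSpace ℝ (Fin n) ↦ ρ ν ‖z‖ := by
  rw [integrable_fun_norm_addHaar, finrank_euclideanSpace_fin]
  exact hρ.integrableOn_pow hn hν

lemma integrable_norm_sub (hρ : IsRDATI n ν₀ ρ) (hn : 1 ≤ n) {ν : ℝ} (hν : ν ∈ Ioo 0 ν₀)
    (x : EuclideanSpace ℝ (Fin n)) :
    Integrable fun y : EuclideanSpace ℝ (Fin n) ↦ ρ ν ‖y - x‖ :=
  (hρ.integrable_norm hn hν).comp_sub_right x

lemma integrable_indicator_norm (hρ : IsRDATI n ν₀ ρ) (hn : 1 ≤ n) {ν : ℝ} (hν : ν ∈ Ioo 0 ν₀)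
    (δ : ℝ) :
    Integrable fun z : EuclideanSpace ℝ (Fin n) ↦ (Ioi δ).indicator (ρ ν) ‖z‖ :=
  (hρ.integrable_norm hn hν).indicator (s := {z | δ < ‖z‖})
    (measurableSet_lt measurable_const measurable_norm)

lemma integral_norm (hρ : IsRDATI n ν₀ ρ) (hn : 1 ≤ n) {ν : ℝ} (hν : ν ∈ Ioo 0 ν₀) :
    ∫ z : EuclideanSpace ℝ (Fin n), ρ ν ‖z‖ =
      n * volume.real (ball (0 : EuclideanSpace ℝ (Fin n)) 1) := by
  rw [integral_fun_norm_addHaar volume (ρ ν), finrank_euclideanSpace_fin]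
  simp only [smul_eq_mul, hρ.integral_pow hn hν, mul_one, nsmul_eq_mul]

lemma integral_indicator_norm (hn : 1 ≤ n) {δ : ℝ} (hδ : 0 < δ) (ν : ℝ) :
    ∫ z : EuclideanSpace ℝ (Fin n), (Ioi δ).indicator (ρ ν) ‖z‖ =
      n * volume.real (ball (0 : EuclideanSpace ℝ (Fin n)) 1) *
        ∫ r in Ioi δ, ρ ν r * r ^ ((n : ℝ) - 1) := by
  rw [integral_fun_norm_addHaar volume ((Ioi δ).indicator (ρ ν)), finrank_euclideanSpace_fin]
  simp only [smul_eq_mul, nsmul_eq_mul, ← mul_assoc]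
  congr 1
  simp_rw [← indicator_mul_right (Ioi δ) (fun r : ℝ ↦ r ^ (n - 1)) (ρ ν)]
  rw [setIntegral_indicator measurableSet_Ioi, Ioi_inter_Ioi, sup_eq_right.2 hδ.le]
  simp only [rpow_eq_pow hn, mul_comm]

/-- The kernels `ρ ν ‖· - x‖` concentrate at `x`: they annihilate in the limit every bounded
function that tends to zero at `x`. -/
lemma tendsto_integral_mul (hρ : IsRDATI n ν₀ ρ) (hn : 1 ≤ n) {x : EuclideanSpace ℝ (Fin n)}
    {K : EuclideanSpace ℝ (Fin n) → ℝ} {M : ℝ} (hM : ∀ y, |K y| ≤ M)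
    (hK : Tendsto K (𝓝 x) (𝓝 0)) :
    Tendsto (fun ν ↦ ∫ y, K y * ρ ν ‖y - x‖) (𝓝[Ioo 0 ν₀] 0) (𝓝 0) := by
  set C : ℝ := n * volume.real (ball (0 : EuclideanSpace ℝ (Fin n)) 1)
  have hC : 0 ≤ C := by positivity
  have hM0 : 0 ≤ M := (abs_nonneg _).trans (hM x)
  refine Metric.tendsto_nhds.2 fun η hη ↦ ?_
  set θ : ℝ := η / (2 * (C + 1))
  have hθ : 0 < θ := by positivity
  obtain ⟨δ, hδ, hKδ⟩ := Metric.eventually_nhds_iff.1 (Metric.tendsto_nhds.1 hK θ hθ)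
  have hδ2 : 0 < δ / 2 := by positivity
  have hlim : Tendsto (fun ν ↦ θ * C + M * (C * ∫ r in Ioi (δ / 2), ρ ν r * r ^ ((n : ℝ) - 1)))
      (𝓝[Ioo 0 ν₀] 0) (𝓝 (θ * C)) := by
    simpa using (((hρ.tail _ hδ2).const_mul C).const_mul M).const_add (θ * C)
  have hθC : θ * C < η := by
    have : θ * (2 * (C + 1)) = η := div_mul_cancel₀ _ (by positivity)
    nlinarith
  filter_upwards [hlim.eventually_lt_const hθC, self_mem_nhdsWithin] with ν hlt hν
  rw [dist_zero_right]
  refine lt_of_le_of_lt ?_ hlt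
  have hi1 := (hρ.integrable_norm_sub hn hν x).const_mul θ
  have hi2 := ((hρ.integrable_indicator_norm hn hν (δ / 2)).comp_sub_right x).const_mul M
  have hbound : ∀ᵐ y, ‖K y * ρ ν ‖y - x‖‖ ≤
      θ * ρ ν ‖y - x‖ + M * (Ioi (δ / 2)).indicator (ρ ν) ‖y - x‖ := by
    filter_upwards [compl_mem_ae_iff.2 (measure_singleton x)] with y hy
    have hpos : 0 < ‖y - x‖ := norm_pos_iff.2 (sub_ne_zero.2 hy)
    have hnn := hρ.nonneg ν hν _ hpos
    rw [norm_mul, Real.norm_of_nonneg hnn, Real.norm_eq_abs]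
    by_cases hfar : δ / 2 < ‖y - x‖
    · rw [indicator_of_mem (mem_Ioi.2 hfar)]
      nlinarith [mul_le_mul_of_nonneg_right (hM y) hnn, mul_nonneg hθ.le hnn]
    · rw [indicator_of_notMem (by simpa using hfar), mul_zero, add_zero]
      have hy' : dist y x < δ := by rw [dist_eq_norm]; linarith
      have := hKδ hy'
      rw [dist_zero_right, Real.norm_eq_abs] at this
      gcongr
  refine (norm_integral_le_of_norm_le (hi1.add hi2) hbound).trans_eq ?_
  simp only [Pi.add_apply]
  rw [integral_add hi1 hi2, integral_const_mul, integral_const_mul,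
    integral_sub_right_eq_self (fun y : EuclideanSpace ℝ (Fin n) ↦ ρ ν ‖y‖) x,
    integral_sub_right_eq_self
      (fun y : EuclideanSpace ℝ (Fin n) ↦ (Ioi (δ / 2)).indicator (ρ ν) ‖y‖) x,
    hρ.integral_norm hn hν, integral_indicator_norm hn hδ2]

lemma integral_directional (hρ : IsRDATI n ν₀ ρ) (hn : 1 ≤ n) {ν : ℝ} (hν : ν ∈ Ioo 0 ν₀)
    {p : ℝ} (hp : 0 < p) {e : EuclideanSpace ℝ (Fin n)} (he : ‖e‖ = 1)
    (v x : EuclideanSpace ℝ (Fin n)) :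
    ∫ y, directional p v (y - x) * ρ ν ‖y - x‖ =
      (∫ ω : sphere (0 : EuclideanSpace ℝ (Fin n)) 1, |⟪e, (ω : EuclideanSpace ℝ (Fin n))⟫| ^ p
        ∂((volume : Measure (EuclideanSpace ℝ (Fin n))).toSphere)) * ‖v‖ ^ p := by
  rw [integral_sub_right_eq_self
      (fun z : EuclideanSpace ℝ (Fin n) ↦ directional p v z * ρ ν ‖z‖) x,
    integral_directional_mul_radial hp he,
    integral_homogeneous_mul_radial volume fun r hr z ↦ directional_smul_right p e hr z,
    finrank_euclideanSpace_fin, hρ.integral_pow hn hν, mul_one, mul_comm]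
  simp [directional]

end IsRDATI

theorem pointwise_asymptotics_smooth_functions (n : ℕ) (hn : 1 ≤ n)
    (ε : ℝ) (hε : ε ∈ Set.Ioc (0:ℝ) 1)
    (Ω : Set (EuclideanSpace ℝ (Fin n))) (hΩ : IsUniformDomain ε Ω)
    (hb : Bornology.IsBounded Ω)
    (p : ℝ) (hp : 0 < p) (ν₀ : ℝ) (ρ : ℝ → ℝ → ℝ) (hρ : IsRDATI n ν₀ ρ)
    (F : EuclideanSpace ℝ (Fin n) → ℝ) (hF : ContDiff ℝ (⊤ : ℕ∞) F)
    (e : EuclideanSpace ℝ (Fin n)) (he : ‖e‖ = 1) :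
    ∀ x ∈ Ω,
      Tendsto (fun ν => ∫ y in Ω, |F x - F y| ^ p / dist x y ^ p * ρ ν (dist x y))
        (nhdsWithin 0 (Set.Ioo 0 ν₀))
        (nhds ((∫ ω : Metric.sphere (0 : EuclideanSpace ℝ (Fin n)) 1,
            |⟪e, (ω : EuclideanSpace ℝ (Fin n))⟫| ^ p
            ∂((volume : Measure (EuclideanSpace ℝ (Fin n))).toSphere))
          * ‖gradient F x‖ ^ p)) := by
  intro x hx
  have : Nontrivial (EuclideanSpace ℝ (Fin n)) := ⟨e, 0, norm_ne_zero_iff.1 (by simp [he])⟩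
  set v := gradient F x
  set g : EuclideanSpace ℝ (Fin n) → ℝ := fun y ↦ (|F x - F y| / ‖y - x‖) ^ p
  have hg0 : ∀ y, 0 ≤ g y := fun y ↦ by positivity
  have hgm : Measurable g :=
    ((continuous_const.sub hF.continuous).abs.measurable.div
      (continuous_id.sub continuous_const).norm.measurable).pow_const p
  obtain ⟨L, hL⟩ : ∃ L : ℝ, ∀ y ∈ Ω, g y ≤ L := by
    obtain ⟨R, hR⟩ := hb.subset_closedBall x
    obtain ⟨L, hL⟩ := hF.contDiffOn.exists_lipschitzOnWith (by simp) (convex_closedBall x R)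
      (isCompact_closedBall x R)
    refine ⟨L ^ p, fun y hy ↦ Real.rpow_le_rpow (by positivity) ?_ hp.le⟩
    refine div_le_of_le_mul₀ (norm_nonneg _) L.2 ?_
    have := hL.dist_le_mul x (hR hx) y (hR hy)
    rwa [Real.dist_eq, dist_comm, dist_eq_norm] at this
  have hΩm : MeasurableSet Ω := hΩ.1.measurableSet
  have hL0 : 0 ≤ L := (hg0 x).trans (hL x hx)
  have hind : ∀ y, |Ω.indicator g y| ≤ L := fun y ↦ by
    rw [abs_of_nonneg (indicator_nonneg (fun y _ ↦ hg0 y) y)]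
    exact indicator_le' (fun y hy ↦ hL y hy) (fun _ _ ↦ hL0) y
  have hdir : ∀ y, |directional p v (y - x)| ≤ ‖v‖ ^ p := fun y ↦ by
    rw [abs_of_nonneg (directional_nonneg _ _ _)]
    exact directional_le hp.le _ _
  have hdirm : Measurable fun y ↦ directional p v (y - x) :=
    (measurable_directional p v).comp (measurable_id.sub_const x)
  have hlim := hρ.tendsto_integral_mul hn (x := x)
    (K := fun y ↦ Ω.indicator g y - directional p v (y - x)) (M := L + ‖v‖ ^ p)
    (fun y ↦ (abs_sub _ _).trans (add_le_add (hind y) (hdir y)))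
    (((hF.differentiable (by simp)).differentiableAt.tendsto_slope_rpow_sub_directional hp).congr'
      (by filter_upwards [hΩ.1.mem_nhds hx] with y hy using by simp [indicator_of_mem hy, g, v]))
  rw [← tendsto_sub_nhds_zero_iff]
  refine hlim.congr' ?_
  filter_upwards [self_mem_nhdsWithin] with ν hν
  have hρint := hρ.integrable_norm_sub hn hν x
  simp only [sub_mul]
  rw [integral_sub
      (hρint.bdd_mul (hgm.indicator hΩm).aestronglyMeasurable (.of_forall hind))
      (hρint.bdd_mul hdirm.aestronglyMeasurable (.of_forall hdir)),
    hρ.integral_directional hn hν hp he]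
  congr 1
  rw [← integral_indicator hΩm]
  congr 1 with y
  by_cases hy : y ∈ Ω
  · simp only [indicator_of_mem hy, g]
    rw [dist_comm, dist_eq_norm, Real.div_rpow (abs_nonneg _) (norm_nonneg _)]
  · simp [indicator_of_notMem hy]

end
end
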